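/- Let H ⊆ ℕ^d be a normal simplicial fully embedded affine semigroup with extremal rays a_1,…,a_d, let K be a field and R = K[H] the semigroup ring. Then for any nonzero b ∈ H, the sequence x^b, x^{a_1}−x^{a_2}, x^{a_1}−x^{a_3}, …, x^{a_1}−x^{a_d} is a regular sequence on R. -/

import Mathlib

open scoped BigOperators

set_option maxHeartbeats 1000000
set_option synthInstance.maxHeartbeats 400000

noncomputable section

namespace AffineSG

variable {d : ℕ}

/-- Real vector attached to a lattice point of `ℕ^d`. -/
def toR (h : Fin d → ℕ) : Fin d → ℝ := fun i => (h i : ℝ)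

/-- Integer vector attached to a lattice point of `ℕ^d`. -/
def toZ (h : Fin d → ℕ) : Fin d → ℤ := fun i => (h i : ℤ)

/-- The rational polyhedral cone generated by the affine semigroup `H`:
all finite nonnegative real combinations of elements of `H`. -/
def coneOf (H : AddSubmonoid (Fin d → ℕ)) : Set (Fin d → ℝ) :=
  {z | ∃ (n : ℕ) (c : Fin n → ℝ) (v : Fin n → (Fin d → ℕ)),
    (∀ k, 0 ≤ c k) ∧ (∀ k, v k ∈ H) ∧ z = ∑ k, c k • toR (v k)}

/-- `v` spans an extremal ray of the (pointed) cone `C`. -/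
def IsExtremalRay (C : Set (Fin d → ℝ)) (v : Fin d → ℝ) : Prop :=
  v ∈ C ∧ v ≠ 0 ∧ ∀ x ∈ C, ∀ y ∈ C, x + y = v → ∃ t : ℝ, 0 ≤ t ∧ x = t • v

/-- `ω_H`: the lattice points in the relative interior of the cone of `H`
(for a fully embedded semigroup the cone is full-dimensional, so the relative
interior is the topological interior; all such lattice points lie in `ℕ^d`). -/
def omegaSet (H : AddSubmonoid (Fin d → ℕ)) : Set (Fin d → ℕ) :=
  {h | toR h ∈ interior (coneOf H)}

/-- The Hilbert basis of `H`: its irreducible nonzero elements, i.e. the unique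
minimal generating set of the (pointed) affine semigroup `H ⊆ ℕ^d`. -/
def hilbertBasis (H : AddSubmonoid (Fin d → ℕ)) : Set (Fin d → ℕ) :=
  {h | h ∈ H ∧ h ≠ 0 ∧ ∀ u v : Fin d → ℕ, u ∈ H → v ∈ H → u ≠ 0 → v ≠ 0 → h ≠ u + v}

/-- `H` is a normal semigroup. -/
def Normal (H : AddSubmonoid (Fin d → ℕ)) : Prop :=
  ∀ (h : Fin d → ℕ) (n : ℕ), 0 < n → n • h ∈ H → h ∈ H

/-- `H` is fully embedded in `ℕ^d`: the group generated by `H` is all of `ℤ^d`. -/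
def FullyEmbedded (H : AddSubmonoid (Fin d → ℕ)) : Prop :=
  AddSubgroup.closure (toZ '' (H : Set (Fin d → ℕ))) = (⊤ : AddSubgroup (Fin d → ℤ))

/-- `H` is simplicial with extremal rays `a 1, …, a d`: each `a i` is a primitive
lattice vector of `H` spanning an extremal ray of the cone, the `a i` are
linearly independent over `ℝ` (they form an `ℝ`-basis of `ℝ^d`), and every
extremal ray of the cone is spanned by some `a i`. -/
def SimplicialWithRays (H : AddSubmonoid (Fin d → ℕ)) (a : Fin d → (Fin d → ℕ)) : Prop :=
  (∀ i, a i ∈ H) ∧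
  (∀ i, IsExtremalRay (coneOf H) (toR (a i))) ∧
  (∀ i, Finset.univ.gcd (a i) = 1) ∧
  LinearIndependent ℝ (fun i => toR (a i)) ∧
  (∀ v, IsExtremalRay (coneOf H) v → ∃ (i : Fin d) (t : ℝ), 0 ≤ t ∧ v = t • toR (a i))

/-- `H` is slim: for every `c` in the Hilbert basis outside `ω_H`, the sum of the
coordinates of `c` with respect to the basis `a 1, …, a d` is at least `1`. -/
def Slim (H : AddSubmonoid (Fin d → ℕ)) (a : Fin d → (Fin d → ℕ)) : Prop :=
  ∀ c ∈ hilbertBasis H \ omegaSet H,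
    ∀ lam : Fin d → ℝ, toR c = ∑ i, lam i • toR (a i) → 1 ≤ ∑ i, lam i

/-- The minimal generating set `G(ω_H)` of the semigroup ideal `ω_H`. -/
def minGens (H : AddSubmonoid (Fin d → ℕ)) : Set (Fin d → ℕ) :=
  {g | g ∈ omegaSet H ∧ ∀ g' ∈ omegaSet H, ∀ h ∈ H, h ≠ 0 → g ≠ g' + h}

variable (K : Type*) [Field K]

/-- The monomial `x^h` of `K[x_1,…,x_d]`. -/
def mono (h : Fin d → ℕ) : MvPolynomial (Fin d) K :=
  MvPolynomial.monomial (Finsupp.equivFunOnFinite.symm h) 1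

/-- The semigroup ring `R = K[H] ⊆ K[x_1,…,x_d]`, spanned by the monomials `x^h`, `h ∈ H`. -/
def sgRing (H : AddSubmonoid (Fin d → ℕ)) : Subalgebra K (MvPolynomial (Fin d) K) :=
  Algebra.adjoin K {p | ∃ h ∈ H, p = mono K h}

/-- The monomial `x^h` as an element of `K[H]`. -/
def xpow {H : AddSubmonoid (Fin d → ℕ)} {h : Fin d → ℕ} (hh : h ∈ H) : sgRing K H :=
  ⟨mono K h, Algebra.subset_adjoin ⟨h, hh, rfl⟩⟩

/-- The graded maximal ideal `𝔪` of `K[H]`, generated by all `x^h`, `0 ≠ h ∈ H`. -/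
def maxIdeal (H : AddSubmonoid (Fin d → ℕ)) : Ideal (sgRing K H) :=
  Ideal.span {p | ∃ h, (h ∈ H ∧ h ≠ 0) ∧ (p : MvPolynomial (Fin d) K) = mono K h}

/-- The canonical module `ω_R` of `R = K[H]`, realized as the ideal of `R`
generated by the monomials `x^h`, `h ∈ ω_H`. -/
def canIdeal (H : AddSubmonoid (Fin d → ℕ)) : Ideal (sgRing K H) :=
  Ideal.span {p | ∃ h ∈ omegaSet H, (p : MvPolynomial (Fin d) K) = mono K h}

/-- The ideal `J = (x^{a_i} - x^{a_j} : 1 ≤ i,j ≤ d) R`. -/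
def Jideal (H : AddSubmonoid (Fin d → ℕ)) (a : Fin d → (Fin d → ℕ)) : Ideal (sgRing K H) :=
  Ideal.span {p | ∃ i j : Fin d, (p : MvPolynomial (Fin d) K) = mono K (a i) - mono K (a j)}

/-- The principal ideal `x^b R` of `R = K[H]`. -/
def prIdeal (H : AddSubmonoid (Fin d → ℕ)) (b : Fin d → ℕ) : Ideal (sgRing K H) :=
  Ideal.span {p | (p : MvPolynomial (Fin d) K) = mono K b}

/-- `b` is an Ulrich element of `H`: `𝔪 ω_R ⊆ x^b R + J ω_R`. -/
def IsUlrich (H : AddSubmonoid (Fin d → ℕ)) (a : Fin d → (Fin d → ℕ)) (b : Fin d → ℕ) : Prop :=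
  maxIdeal K H * canIdeal K H ≤ prIdeal K H b ⊔ Jideal K H a * canIdeal K H

/-- The principal ideal `(x^{a_1} - x^{a_2}) R` (for `d = 2`). -/
def diffIdeal (H : AddSubmonoid (Fin 2 → ℕ)) (a1 a2 : Fin 2 → ℕ) : Ideal (sgRing K H) :=
  Ideal.span {p | (p : MvPolynomial (Fin 2) K) = mono K a1 - mono K a2}

/-- For `d = 2`: `b` is an Ulrich element of `H`, i.e.
`𝔪 ω_R ⊆ x^b R + (x^{a_1} - x^{a_2}) ω_R`. -/
def IsUlrich2 (H : AddSubmonoid (Fin 2 → ℕ)) (a1 a2 b : Fin 2 → ℕ) : Prop :=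
  maxIdeal K H * canIdeal K H ≤ prIdeal K H b ⊔ diffIdeal K H a1 a2 * canIdeal K H

/-- For `d = 2`: the lattice points `H_i = C_i ∩ ℤ²` of the cone generated by `b` and `a`. -/
def coneTwo (b a : Fin 2 → ℕ) : Set (Fin 2 → ℕ) :=
  {p | ∃ lam mu : ℝ, 0 ≤ lam ∧ 0 ≤ mu ∧ toR p = lam • toR b + mu • toR a}

/-- For `d = 2`: `H_i^* = ℤ² ∩ relint P_{H_i}`, the lattice points in the relative
interior of the fundamental parallelogram spanned by `b` and `a`. -/
def Hstar (b a : Fin 2 → ℕ) : Set (Fin 2 → ℕ) :=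
  {p | ∃ lam mu : ℝ, 0 < lam ∧ lam < 1 ∧ 0 < mu ∧ mu < 1 ∧
    toR p = lam • toR b + mu • toR a}

/-- `b` is the bottom element of `H`: the (unique) componentwise-minimal element of `ω_H`. -/
def IsBottom (H : AddSubmonoid (Fin 2 → ℕ)) (b : Fin 2 → ℕ) : Prop :=
  b ∈ omegaSet H ∧ ∀ c ∈ omegaSet H, b ≤ c

/-- The condition AG1 (for `a = a_1`), resp. AG2 (for `a = a_2`):
the sum of two points of `H_i^*` is never in `H_i^*`. -/
def AGcond (b a : Fin 2 → ℕ) : Prop :=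
  ∀ p ∈ Hstar b a, ∀ q ∈ Hstar b a, p + q ∉ Hstar b a

end AffineSG

end

namespace AffineSG

open RingTheory.Sequence

/-- If `x` is regular on every successive quotient of `M` by a weakly regular sequence `rs`,
then `x` may be prepended to `rs`. -/
theorem isWeaklyRegular_cons_of_take {R M : Type*} [CommRing R] [AddCommGroup M] [Module R M]
    {x : R} {rs : List R} (h : ∀ i ≤ rs.length, IsWeaklyRegular M (rs.take i ++ [x])) :
    IsWeaklyRegular M (x :: rs) := by
  induction rs generalizing M with
  | nil => simpa using h 0
  | cons r rs ih =>
    have hx : IsSMulRegular M x := by simpa using h 0 (by simp)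
    have hr : IsSMulRegular M r := by
      have := h 1 (by simp)
      simp only [List.take_succ_cons, List.take_zero, List.cons_append, List.nil_append,
        isWeaklyRegular_cons_iff] at this
      exact this.1
    have hM := ih (M := QuotSMulTop r M) fun i hi => by
      have := h (i + 1) (by simpa using hi)
      rw [List.take_succ_cons, List.cons_append, isWeaklyRegular_cons_iff] at this
      exact this.2
    have hrx : IsWeaklyRegular M ([r, x] ++ rs) := (isWeaklyRegular_cons_iff M r _).mpr ⟨hr, hM⟩
    have hxr : IsWeaklyRegular M [x, r] := by
      refine (isWeaklyRegular_cons_iff M x _).mpr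
        ⟨hx, (isWeaklyRegular_singleton_iff _ _).mpr ?_⟩
      have hxM : IsSMulRegular (QuotSMulTop r M) x := ((isWeaklyRegular_cons_iff _ _ _).mp hM).1
      rw [isSMulRegular_quotient_iff_mem_of_smul_mem] at hxM ⊢
      intro m hm
      obtain ⟨n, -, hn⟩ := (Submodule.mem_smul_pointwise_iff_exists _ _ _).mp hm
      obtain ⟨n', -, rfl⟩ := (Submodule.mem_smul_pointwise_iff_exists _ _ _).mp
        (hxM n (hn ▸ Submodule.smul_mem_pointwise_smul _ _ _ trivial))
      rw [smul_comm] at hn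
      rw [← hr hn]
      exact Submodule.smul_mem_pointwise_smul _ _ _ trivial
    change IsWeaklyRegular M ([x, r] ++ rs)
    rw [isWeaklyRegular_append_iff] at hrx ⊢
    have : Ideal.ofList [r, x] = Ideal.ofList [x, r] :=
      congrArg Ideal.span <| Set.ext fun _ => (List.Perm.swap x r []).mem_iff
    rw [(Submodule.quotEquivOfEq _ _ (congrArg (· • ⊤) this)).isWeaklyRegular_congr] at hrx
    exact ⟨hxr, hrx.2⟩

theorem isWeaklyRegular_concat_of_pow {R M : Type*} [CommRing R] [AddCommGroup M] [Module R M]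
    {x : R} {rs : List R} {n : ℕ} (hn : 0 < n) (h : IsWeaklyRegular M (rs ++ [x ^ n])) :
    IsWeaklyRegular M (rs ++ [x]) := by
  rw [isWeaklyRegular_append_iff, isWeaklyRegular_singleton_iff] at h ⊢
  rwa [IsSMulRegular.pow_iff hn] at h

section Polynomial

open MvPolynomial

variable (K : Type*) [Field K]

/-- The sequence `X₀ - X₁, …, X₀ - X_{d-1}` in `K[X₀, …, X_{d-1}]`. -/
noncomputable def diffList (d : ℕ) (hd : 0 < d) : List (MvPolynomial (Fin d) K) :=
  List.ofFn fun j : Fin (d - 1) => X ⟨0, hd⟩ - X ⟨1 + j.1, by omega⟩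

/-- The retraction of `K[X₀, …, X_{d-1}]` that replaces the variables `X₀, …, X_k` by `X₀`. -/
noncomputable def collapse (d : ℕ) (hd : 0 < d) (k : ℕ) :
    MvPolynomial (Fin d) K →ₐ[K] MvPolynomial (Fin d) K :=
  aeval fun i => if i.1 ≤ k then X ⟨0, hd⟩ else X i

variable {K}

theorem mem_take_diffList {d : ℕ} {hd : 0 < d} {k : ℕ} {p : MvPolynomial (Fin d) K} :
    p ∈ (diffList K d hd).take k ↔ ∃ i : Fin d, 0 < i.1 ∧ i.1 ≤ k ∧ p = X ⟨0, hd⟩ - X i := by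
  simp only [List.mem_take_iff_getElem, diffList, List.getElem_ofFn, List.length_ofFn]
  constructor
  · rintro ⟨j, hj, rfl⟩
    exact ⟨⟨1 + j, by omega⟩, by simp, by simp; omega, rfl⟩
  · rintro ⟨i, hi, hik, rfl⟩
    refine ⟨i.1 - 1, by omega, ?_⟩
    congr 3
    omega

theorem ofList_take_diffList (d : ℕ) (hd : 0 < d) (k : ℕ) :
    Ideal.ofList ((diffList K d hd).take k) = RingHom.ker (collapse K d hd k) := by
  apply le_antisymm
  · refine Ideal.span_le.mpr fun p hp => ?_
    obtain ⟨i, -, hik, rfl⟩ := mem_take_diffList.mp hp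
    simp [collapse, hik, RingHom.mem_ker]
  · intro p hp
    set I := Ideal.ofList ((diffList K d hd).take k)
    have key : (Ideal.Quotient.mkₐ K I).comp (collapse K d hd k) = Ideal.Quotient.mkₐ K I := by
      refine MvPolynomial.algHom_ext fun i => ?_
      simp only [collapse, AlgHom.comp_apply, aeval_X]
      split_ifs with hik
      · refine Ideal.Quotient.eq.mpr ?_
        obtain hi | hi := Nat.eq_zero_or_pos i.1
        · have : i = ⟨0, hd⟩ := Fin.ext hi
          simp [this]
        · exact Ideal.subset_span (mem_take_diffList.mpr ⟨i, hi, hik, rfl⟩)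
      · rfl
    have := DFunLike.congr_fun key p
    rw [AlgHom.comp_apply, RingHom.mem_ker.mp hp, map_zero] at this
    exact Ideal.Quotient.eq_zero_iff_mem.mp this.symm

theorem isSMulRegular_quotient_take_diffList {d : ℕ} {hd : 0 < d} {k : ℕ}
    {p : MvPolynomial (Fin d) K} (hp : collapse K d hd k p ≠ 0) :
    IsSMulRegular (MvPolynomial (Fin d) K ⧸
      (Ideal.ofList ((diffList K d hd).take k) • ⊤ :
        Submodule (MvPolynomial (Fin d) K) (MvPolynomial (Fin d) K))) p := by
  rw [isSMulRegular_quotient_iff_mem_of_smul_mem, smul_eq_mul, Ideal.mul_top,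
    ofList_take_diffList]
  intro q hq
  rw [RingHom.mem_ker, smul_eq_mul, map_mul] at hq
  exact (mul_eq_zero.mp hq).resolve_left hp

theorem isWeaklyRegular_diffList (d : ℕ) (hd : 0 < d) :
    IsWeaklyRegular (MvPolynomial (Fin d) K) (diffList K d hd) := by
  refine ⟨fun k hk => isSMulRegular_quotient_take_diffList ?_⟩
  simp only [diffList, List.getElem_ofFn, collapse, map_sub, aeval_X, zero_le, if_true]
  rw [if_neg (by omega), sub_ne_zero, Ne, X_injective.eq_iff, Fin.mk.injEq]
  omega

theorem isWeaklyRegular_take_diffList_concat_monomial (d : ℕ) (hd : 0 < d) (k : ℕ)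
    (m : Fin d →₀ ℕ) :
    IsWeaklyRegular (MvPolynomial (Fin d) K)
      ((diffList K d hd).take k ++ [monomial m (1 : K)]) := by
  rw [isWeaklyRegular_append_iff, isWeaklyRegular_singleton_iff]
  constructor
  · have := isWeaklyRegular_diffList (K := K) d hd
    rw [← List.take_append_drop k (diffList K d hd), isWeaklyRegular_append_iff] at this
    exact this.1
  · apply isSMulRegular_quotient_take_diffList
    rw [collapse, aeval_monomial, map_one, one_mul, Finsupp.prod, Finset.prod_ne_zero_iff]
    intro i _
    apply pow_ne_zero
    split_ifs <;> exact X_ne_zero _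

theorem isWeaklyRegular_cons_map_diffList {R : Type*} [CommRing R] {d : ℕ} (hd : 0 < d)
    [Algebra (MvPolynomial (Fin d) K) R] [Module.Flat (MvPolynomial (Fin d) K) R]
    {x : R} {n : ℕ} (hn : 0 < n) {m : Fin d →₀ ℕ}
    (hx : x ^ n = algebraMap (MvPolynomial (Fin d) K) R (monomial m 1)) :
    IsWeaklyRegular R (x :: (diffList K d hd).map (algebraMap _ R)) := by
  refine isWeaklyRegular_cons_of_take fun k _ => isWeaklyRegular_concat_of_pow hn ?_
  have := (isWeaklyRegular_take_diffList_concat_monomial (K := K) d hd k m).of_flat (S := R)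
  rwa [List.map_append, List.map_singleton, ← hx, List.map_take] at this

end Polynomial

end AffineSG

namespace AffineSG

open PointedCone

theorem toR_nonneg {d : ℕ} (h : Fin d → ℕ) : 0 ≤ toR h := fun i => by simp [toR]

theorem toR_add {d : ℕ} (g h : Fin d → ℕ) : toR (g + h) = toR g + toR h := by
  ext i
  simp [toR]

theorem toR_mem_coneOf {d : ℕ} {H : AddSubmonoid (Fin d → ℕ)} {h : Fin d → ℕ} (hh : h ∈ H) :
    toR h ∈ coneOf H :=
  ⟨1, fun _ => 1, fun _ => h, by simp, by simpa using hh, by simp⟩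

theorem nonneg_of_mem_hull {d : ℕ} {T : Set (Fin d → ℝ)} (hT : ∀ t ∈ T, 0 ≤ t) {x : Fin d → ℝ}
    (hx : x ∈ hull ℝ T) : 0 ≤ x := by
  induction hx using Submodule.span_induction with
  | mem t ht => exact hT t ht
  | zero => exact le_rfl
  | add u v _ _ hu hv => exact add_nonneg hu hv
  | smul c u _ hu => exact smul_nonneg c.2 hu

theorem coneOf_subset {d : ℕ} {H : AddSubmonoid (Fin d → ℕ)} {C : PointedCone ℝ (Fin d → ℝ)}
    (hC : ∀ h ∈ H, toR h ∈ C) {x : Fin d → ℝ} (hx : x ∈ coneOf H) : x ∈ C := by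
  obtain ⟨n, c, v, hc, hv, rfl⟩ := hx
  exact Submodule.sum_mem _ fun k _ => C.smul_mem (hc k) (hC _ (hv k))

/-- A member of an irredundant finite generating set of the cone of `H` spans an extremal ray. -/
theorem isExtremalRay_of_notMem_hull {d : ℕ} {H : AddSubmonoid (Fin d → ℕ)}
    {T : Set (Fin d → ℝ)} (hT : ∀ t ∈ T, 0 ≤ t) {t : Fin d → ℝ} (htH : t ∈ coneOf H)
    (htT : t ∉ hull ℝ T) (hTH : ∀ h ∈ H, toR h ∈ hull ℝ (insert t T)) :
    IsExtremalRay (coneOf H) t := by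
  have ht0 : 0 ≤ t := by
    obtain ⟨n, c, v, hc, -, rfl⟩ := htH
    exact Finset.sum_nonneg fun k _ => smul_nonneg (hc k) (toR_nonneg _)
  refine ⟨htH, fun h => htT (h ▸ zero_mem _), fun x hx y hy hxy => ?_⟩
  obtain ⟨α, u, hu, rfl⟩ := Submodule.mem_span_insert.mp (coneOf_subset hTH hx)
  obtain ⟨β, v, hv, rfl⟩ := Submodule.mem_span_insert.mp (coneOf_subset hTH hy)
  have huv : u + v = (1 - α.1 - β.1) • t := by
    have : α.1 • t + u + (β.1 • t + v) = t := hxy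
    rw [sub_smul, sub_smul, one_smul]
    nth_rewrite 1 [← this]
    abel
  have hu0 := nonneg_of_mem_hull hT hu
  have hv0 := nonneg_of_mem_hull hT hv
  refine ⟨α.1, α.2, ?_⟩
  have hle : 1 - α.1 - β.1 ≤ 0 := by
    by_contra! hpos
    refine htT ?_
    have : t = (⟨(1 - α.1 - β.1)⁻¹, by positivity⟩ : {r : ℝ // 0 ≤ r}) • (u + v) := by
      rw [huv]
      exact (inv_smul_smul₀ hpos.ne' t).symm
    rw [this]
    exact Submodule.smul_mem _ _ (Submodule.add_mem _ hu hv)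
  have : u = 0 := by
    refine le_antisymm ?_ hu0
    calc u ≤ u + v := le_add_of_nonneg_right hv0
      _ = (1 - α.1 - β.1) • t := huv
      _ ≤ 0 := smul_nonpos_of_nonpos_of_nonneg hle ht0
  rw [this, add_zero]
  rfl

/-- The cone of a finitely generated `H` is generated by its extremal rays. -/
theorem exists_nonneg_coords {d : ℕ} {H : AddSubmonoid (Fin d → ℕ)} (hFG : H.FG)
    {a : Fin d → Fin d → ℕ}
    (ha : ∀ v, IsExtremalRay (coneOf H) v → ∃ (i : Fin d) (t : ℝ), 0 ≤ t ∧ v = t • toR (a i))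
    {h : Fin d → ℕ} (hh : h ∈ H) :
    ∃ c : Fin d → ℝ, (∀ i, 0 ≤ c i) ∧ toR h = ∑ i, c i • toR (a i) := by
  classical
  obtain ⟨S, hS⟩ := hFG
  let T₀ := S.image toR
  obtain ⟨T, hT, hmin⟩ := Finset.exists_min_image
    (T₀.powerset.filter fun T : Finset (Fin d → ℝ) =>
      (T₀ : Set (Fin d → ℝ)) ⊆ hull ℝ (T : Set (Fin d → ℝ)))
    Finset.card ⟨T₀, by simp⟩
  simp only [Finset.mem_filter, Finset.mem_powerset] at hT hmin
  obtain ⟨hTT₀, hT⟩ := hT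
  have hT0 : ∀ t ∈ T, ∃ s ∈ H, t = toR s := fun t ht => by
    obtain ⟨s, hs, rfl⟩ := Finset.mem_image.mp (hTT₀ ht)
    exact ⟨s, hS ▸ AddSubmonoid.subset_closure hs, rfl⟩
  have hH : ∀ h ∈ H, toR h ∈ hull ℝ (T : Set (Fin d → ℝ)) := by
    intro h hh
    rw [← hS] at hh
    induction hh using AddSubmonoid.closure_induction with
    | mem s hs => exact hT (Finset.mem_coe.mpr (Finset.mem_image_of_mem _ hs))
    | zero =>
      convert zero_mem (hull ℝ (T : Set (Fin d → ℝ)))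
      ext
      simp [toR]
    | add g h _ _ hg hh => exact toR_add g h ▸ add_mem hg hh
  have hTa : ∀ t ∈ T, t ∈ hull ℝ (Set.range fun i => toR (a i)) := by
    intro t ht
    obtain ⟨s, hs, hts⟩ := hT0 t ht
    have hins : (T : Set (Fin d → ℝ)) = insert t ((T.erase t : Finset _) : Set (Fin d → ℝ)) := by
      rw [← Finset.coe_insert, Finset.insert_erase ht]
    obtain ⟨i, c, hc, h⟩ := ha t <| isExtremalRay_of_notMem_hull
      (T := ((T.erase t : Finset _) : Set (Fin d → ℝ)))
      (fun u hu => by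
        obtain ⟨s, -, rfl⟩ := hT0 u (Finset.mem_of_mem_erase hu)
        exact toR_nonneg s)
      (hts ▸ toR_mem_coneOf hs)
      (fun hmem => by
        have := hmin (T.erase t) ⟨(Finset.erase_subset _ _).trans hTT₀, ?_⟩
        · exact (Finset.card_erase_lt_of_mem ht).not_ge this
        · refine hT.trans (Submodule.span_le.mpr ?_)
          rw [hins]
          exact Set.insert_subset hmem subset_hull)
      (fun h hh => hins ▸ hH h hh)
    rw [h]
    exact Submodule.smul_mem _ (⟨c, hc⟩ : {r : ℝ // 0 ≤ r}) (subset_hull ⟨i, rfl⟩)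
  obtain ⟨c, hc⟩ := (Submodule.mem_span_range_iff_exists_fun _).mp
    (Submodule.span_le.mpr hTa (hH h hh))
  exact ⟨fun i => c i, fun i => (c i).2, hc.symm⟩

/-- Integral coordinates, up to a common denominator, with respect to a basis of `ℝ^d`
consisting of lattice points. -/
theorem exists_integral_coords {d : ℕ} {a : Fin d → Fin d → ℕ}
    (ha : LinearIndependent ℝ fun i => toR (a i)) :
    ∃ (N : ℕ) (μ : (Fin d → ℤ) →ₗ[ℤ] (Fin d → ℤ)), 0 < N ∧
      ∀ z, (N : ℤ) • z = ∑ i, μ z i • toZ (a i) := by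
  let A : Matrix (Fin d) (Fin d) ℤ := Matrix.of fun k i => (a i k : ℤ)
  have hA : A.det ≠ 0 := by
    have h : IsUnit (A.map (Int.castRingHom ℝ)) := by
      rw [← Matrix.linearIndependent_cols_iff_isUnit]
      exact ha
    rw [Matrix.isUnit_iff_isUnit_det, ← RingHom.mapMatrix_apply, ← RingHom.map_det] at h
    intro h0
    simp [h0] at h
  refine ⟨(A.det ^ 2).natAbs, (A.det • A.adjugate).mulVecLin, by positivity, fun z => ?_⟩
  have h := Matrix.mulVec_mulVec z A (A.det • A.adjugate)
  rw [Matrix.mul_smul, Matrix.mul_adjugate, smul_smul, ← sq,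
    Matrix.smul_mulVec (A.det ^ 2), Matrix.one_mulVec] at h
  rw [Int.natAbs_of_nonneg (sq_nonneg _), ← h]
  change A.mulVec _ = ∑ i, (A.det • A.adjugate).mulVec z i • toZ (a i)
  generalize (A.det • A.adjugate).mulVec z = c
  ext k
  simp [Matrix.mulVec, dotProduct, A, toZ, mul_comm]

theorem coords_unique {d : ℕ} {a : Fin d → Fin d → ℕ}
    (ha : LinearIndependent ℝ fun i => toR (a i)) {c c' : Fin d → ℤ}
    (h : ∑ i, c i • toZ (a i) = ∑ i, c' i • toZ (a i)) : c = c' := by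
  have h' : ∑ i, (c i : ℝ) • toR (a i) = ∑ i, (c' i : ℝ) • toR (a i) := by
    ext k
    have := congrArg (Int.cast (R := ℝ)) (congrFun h k)
    simpa [toZ, toR] using this
  ext i
  exact_mod_cast congrFun (linearIndependent_iff_injective_fintypeLinearCombination.mp ha h') i

theorem toZ_injective {d : ℕ} : Function.Injective (toZ (d := d)) := fun g h hgh => by
  ext i
  exact Int.ofNat_inj.mp (congrFun hgh i)

theorem toZ_nsmul {d : ℕ} (n : ℕ) (g : Fin d → ℕ) : toZ (n • g) = (n : ℤ) • toZ g := by
  ext k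
  simp [toZ]

theorem toZ_sum {d : ℕ} (m : Fin d → ℕ) (a : Fin d → Fin d → ℕ) :
    toZ (∑ i, m i • a i) = ∑ i, (m i : ℤ) • toZ (a i) := by
  ext k
  simp [toZ]

theorem toZ_add_sum {d : ℕ} (g : Fin d → ℕ) (m : Fin d → ℕ) (a : Fin d → Fin d → ℕ) :
    toZ (g + ∑ i, m i • a i) = toZ g + ∑ i, (m i : ℤ) • toZ (a i) := by
  rw [← toZ_sum]
  ext k
  simp [toZ]

/-- The semigroup `H` decomposes as the disjoint union of the translates `g + ∑ ℕ aᵢ`, where `g`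
runs over a set of representatives, and a common multiple of every element of `H` lies in
`∑ ℕ aᵢ`. -/
theorem exists_decomposition {d : ℕ} {H : AddSubmonoid (Fin d → ℕ)} (hFG : H.FG) (hNor : Normal H)
    {a : Fin d → Fin d → ℕ} (hS : SimplicialWithRays H a) :
    (∃ B : Set (Fin d → ℕ), B ⊆ H ∧
      (∀ g ∈ B, ∀ g' ∈ B, ∀ m m' : Fin d → ℕ, g + ∑ i, m i • a i = g' + ∑ i, m' i • a i →
        g = g' ∧ m = m') ∧
      ∀ h ∈ H, ∃ g ∈ B, ∃ m : Fin d → ℕ, h = g + ∑ i, m i • a i) ∧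
    ∃ N : ℕ, 0 < N ∧ ∀ h ∈ H, ∃ m : Fin d → ℕ, N • h = ∑ i, m i • a i := by
  obtain ⟨haH, -, -, hLI, hray⟩ := hS
  obtain ⟨N, μ, hN, hμ⟩ := exists_integral_coords hLI
  have hN' : (0 : ℤ) < N := by exact_mod_cast hN
  have hpos : ∀ h ∈ H, ∀ i, 0 ≤ μ (toZ h) i := by
    intro h hh i
    obtain ⟨c, hc, hhc⟩ := exists_nonneg_coords hFG hray hh
    have h₁ : ∑ i, ((N : ℝ) * c i) • toR (a i) = ∑ i, (μ (toZ h) i : ℝ) • toR (a i) := by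
      simp_rw [mul_smul]
      rw [← Finset.smul_sum, ← hhc]
      ext k
      have := congrArg (Int.cast (R := ℝ)) (congrFun (hμ (toZ h)) k)
      simpa [toZ, toR] using this
    have h₂ := congrFun (linearIndependent_iff_injective_fintypeLinearCombination.mp hLI h₁) i
    have h₃ : (0 : ℝ) ≤ (μ (toZ h) i : ℝ) := h₂ ▸ mul_nonneg N.cast_nonneg (hc i)
    exact_mod_cast h₃
  have hμsum : ∀ z (m : Fin d → ℤ), μ (z + ∑ i, m i • toZ (a i)) = μ z + (N : ℤ) • m := by
    intro z m
    apply coords_unique hLI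
    rw [← hμ, smul_add, hμ, Finset.smul_sum, ← Finset.sum_add_distrib]
    refine Finset.sum_congr rfl fun i _ => ?_
    simp [add_smul, mul_smul]
  have hmem : ∀ (z : Fin d → ℤ), (∀ i, 0 ≤ μ z i) → ∃ g ∈ H, toZ g = z := by
    intro z hz
    have hz0 : 0 ≤ z := by
      intro k
      have h := congrFun (hμ z) k
      have : 0 ≤ (N : ℤ) * z k := by
        rw [Pi.smul_apply, smul_eq_mul] at h
        rw [h, Finset.sum_apply]
        exact Finset.sum_nonneg fun i _ => mul_nonneg (hz i) (Int.natCast_nonneg _)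
      exact nonneg_of_mul_nonneg_right this hN'
    have hgz : toZ (fun k => (z k).toNat) = z := by
      ext k
      exact Int.toNat_of_nonneg (hz0 k)
    refine ⟨_, hNor _ N hN ?_, hgz⟩
    have : N • (fun k => (z k).toNat) = ∑ i, (μ z i).toNat • a i := by
      apply toZ_injective
      simp_rw [toZ_nsmul, toZ_sum, hgz, Int.toNat_of_nonneg (hz _)]
      exact hμ z
    rw [this]
    exact sum_mem fun i _ => nsmul_mem (haH i) _
  refine ⟨⟨{g | g ∈ H ∧ ∀ i, μ (toZ g) i < N}, fun g hg => hg.1, ?_, ?_⟩, N, hN, ?_⟩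
  · rintro g ⟨hg, hgN⟩ g' ⟨hg', hgN'⟩ m m' h
    have hm : m = m' := by
      ext i
      have := congrFun (congrArg (fun x => μ (toZ x)) h) i
      simp only [toZ_add_sum, hμsum, Pi.add_apply, Pi.smul_apply, smul_eq_mul] at this
      have e := congrArg (· / (N : ℤ)) this
      simp only [Int.add_mul_ediv_left _ _ hN'.ne',
        Int.ediv_eq_zero_of_lt (hpos _ hg i) (hgN i),
        Int.ediv_eq_zero_of_lt (hpos _ hg' i) (hgN' i)] at e
      omega
    subst hm
    exact ⟨add_right_cancel h, rfl⟩
  · intro h hh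
    have hq : ∀ i, 0 ≤ μ (toZ h) i / N := fun i => Int.ediv_nonneg (hpos h hh i) hN'.le
    let m : Fin d → ℕ := fun i => (μ (toZ h) i / N).toNat
    have hm : ∀ i, (m i : ℤ) = μ (toZ h) i / N := fun i => Int.toNat_of_nonneg (hq i)
    have hμg : ∀ i, μ (toZ h + ∑ i, (-(m i : ℤ)) • toZ (a i)) i = μ (toZ h) i % N := by
      intro i
      rw [hμsum, Pi.add_apply, Pi.smul_apply, smul_eq_mul, hm, Int.emod_def]
      ring
    obtain ⟨g, hg, hgz⟩ := hmem (toZ h + ∑ i, (-(m i : ℤ)) • toZ (a i)) fun i => by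
      rw [hμg]
      exact Int.emod_nonneg _ hN'.ne'
    refine ⟨g, ⟨hg, fun i => ?_⟩, m, toZ_injective ?_⟩
    · rw [hgz, hμg]
      exact Int.emod_lt_of_pos _ hN'
    · rw [toZ_add_sum, hgz, add_assoc, ← Finset.sum_add_distrib]
      simp
  · intro h hh
    refine ⟨fun i => (μ (toZ h) i).toNat, toZ_injective ?_⟩
    simp_rw [toZ_nsmul, toZ_sum, Int.toNat_of_nonneg (hpos h hh _)]
    exact hμ _

end AffineSG

namespace AffineSG

open MvPolynomial RingTheory.Sequence

/-- A `K`-basis of `R` of the form `y^m eᵢ`, with `y^m` running over all monomials of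
`A = K[y]`, makes `R` a free `A`-module. -/
theorem free_of_basis_monomial_smul {K σ ι R : Type*} [Field K] [CommRing R] [Algebra K R]
    [Algebra (MvPolynomial σ K) R] [IsScalarTower K (MvPolynomial σ K) R] (e : ι → R)
    (v : Module.Basis (Σ _ : ι, σ →₀ ℕ) K R)
    (hv : ∀ p, v p = monomial p.2 (1 : K) • e p.1) :
    Module.Free (MvPolynomial σ K) R := by
  classical
  let Φ := Finsupp.linearCombination (MvPolynomial σ K) e
  let w : Module.Basis (Σ _ : ι, σ →₀ ℕ) K (ι →₀ MvPolynomial σ K) :=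
    Finsupp.basis fun _ => basisMonomials σ K
  have h : Φ.restrictScalars K = (w.equiv v (Equiv.refl _)).toLinearMap := by
    refine w.ext fun p => ?_
    change Φ (w p) = w.equiv v (Equiv.refl _) (w p)
    rw [Module.Basis.equiv_apply, Equiv.refl_apply, hv]
    simp [w, Φ]
  have hbij : Function.Bijective Φ := by
    have : (Φ : (ι →₀ MvPolynomial σ K) → R) = w.equiv v (Equiv.refl _) :=
      congrArg DFunLike.coe h
    rw [this]
    exact (w.equiv v (Equiv.refl _)).bijective
  exact Module.Free.of_equiv (LinearEquiv.ofBijective Φ hbij)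

section Monomials

variable {K : Type*} [Field K] {d : ℕ}

theorem mono_zero : mono K (0 : Fin d → ℕ) = 1 := by
  simp only [mono]
  exact congrArg (fun s => monomial s (1 : K)) (by ext; rfl)

theorem mono_add (g h : Fin d → ℕ) : mono K (g + h) = mono K g * mono K h := by
  simp only [mono, monomial_mul, one_mul]
  exact congrArg (fun s => monomial s (1 : K)) (by ext; rfl)

/-- Exponents to monomials, as a monoid homomorphism. -/
noncomputable def monoHom (K : Type*) [Field K] (d : ℕ) :
    Multiplicative (Fin d → ℕ) →* MvPolynomial (Fin d) K where
  toFun h := mono K h.toAdd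
  map_one' := mono_zero
  map_mul' g h := mono_add g.toAdd h.toAdd

theorem mono_nsmul (n : ℕ) (h : Fin d → ℕ) : mono K (n • h) = mono K h ^ n :=
  map_pow (monoHom K d) (Multiplicative.ofAdd h) n

theorem mono_sum {ι : Type*} (s : Finset ι) (f : ι → Fin d → ℕ) :
    mono K (∑ i ∈ s, f i) = ∏ i ∈ s, mono K (f i) :=
  map_prod (monoHom K d) (fun i => Multiplicative.ofAdd (f i)) s

theorem linearIndependent_mono : LinearIndependent K (mono K : (Fin d → ℕ) → _) :=
  (basisMonomials (Fin d) K).linearIndependent.comp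
    (fun h => Finsupp.equivFunOnFinite.symm h) Finsupp.equivFunOnFinite.symm.injective

variable {H : AddSubmonoid (Fin d → ℕ)}

theorem toSubmodule_sgRing :
    (sgRing K H).toSubmodule = Submodule.span K (mono K '' (H : Set (Fin d → ℕ))) := by
  rw [sgRing, Algebra.adjoin_eq_span]
  congr 1
  have : {p | ∃ h ∈ H, p = mono K h} =
      ((AddSubmonoid.toSubmonoid H).map (monoHom K d) : Set (MvPolynomial (Fin d) K)) := by
    ext p
    constructor
    · rintro ⟨h, hh, rfl⟩
      exact ⟨Multiplicative.ofAdd h, hh, rfl⟩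
    · rintro ⟨h, hh, rfl⟩
      exact ⟨h.toAdd, hh, rfl⟩
  rw [this, Submonoid.closure_eq, ← this]
  ext p
  simp [eq_comm]

/-- The monomial basis of `K[H]`, indexed by any parametrization of `H`. -/
theorem exists_basis_xpow {ι : Type*} (τ : ι → Fin d → ℕ) (hτ : Function.Injective τ)
    (hmem : ∀ i, τ i ∈ H) (hsurj : ∀ h ∈ H, ∃ i, τ i = h) :
    ∃ v : Module.Basis ι K (sgRing K H), ∀ i, v i = xpow K (hmem i) := by
  refine ⟨Module.Basis.mk (v := fun i => xpow K (hmem i)) ?_ ?_,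
    fun i => Module.Basis.mk_apply _ _ i⟩
  · exact LinearIndependent.of_comp (sgRing K H).val.toLinearMap
      (linearIndependent_mono.comp τ hτ)
  · rintro x -
    have hx : x.1 ∈ Submodule.span K (mono K '' (H : Set (Fin d → ℕ))) := by
      rw [← toSubmodule_sgRing]
      exact x.2
    have hle : Submodule.span K (mono K '' (H : Set (Fin d → ℕ))) ≤
        (Submodule.span K (Set.range fun i => xpow K (hmem i))).map
          (sgRing K H).val.toLinearMap := by
      refine Submodule.span_le.mpr ?_
      rintro _ ⟨h, hh, rfl⟩
      obtain ⟨i, rfl⟩ := hsurj h hh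
      exact ⟨xpow K (hmem i), Submodule.subset_span ⟨i, rfl⟩, rfl⟩
    obtain ⟨y, hy, hyx⟩ := hle hx
    rwa [← Subtype.ext (a1 := y) (a2 := x) hyx]

/-- The inclusion of the polynomial ring `K[y_1, …, y_d]` in `K[H]` given by `y_i ↦ x^{a_i}`. -/
noncomputable def rayHom (K : Type*) [Field K] {a : Fin d → Fin d → ℕ} (ha : ∀ i, a i ∈ H) :
    MvPolynomial (Fin d) K →ₐ[K] sgRing K H :=
  aeval fun i => xpow K (ha i)

theorem coe_rayHom_monomial {a : Fin d → Fin d → ℕ} (ha : ∀ i, a i ∈ H) (m : Fin d →₀ ℕ) :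
    (rayHom K ha (monomial m 1) : MvPolynomial (Fin d) K) = mono K (∑ i, m i • a i) := by
  rw [rayHom, aeval_monomial, map_one, one_mul, Finsupp.prod_fintype _ _ fun _ => pow_zero _,
    mono_sum]
  simp only [mono_nsmul, SubmonoidClass.coe_finsetProd,
    SubmonoidClass.coe_pow, xpow]

theorem constantCoeff_mono {h : Fin d → ℕ} (hh : h ≠ 0) : constantCoeff (mono K h) = 0 := by
  rw [mono, constantCoeff_monomial, if_neg]
  intro h0
  exact hh (congrArg Finsupp.equivFunOnFinite h0)

end Monomials

/-- for any nonzero `b ∈ H`, the sequence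
`x^b, x^{a_1}-x^{a_2}, …, x^{a_1}-x^{a_d}` is a regular sequence on `R = K[H]`. -/
theorem statement_0 (d : ℕ) (hd : 0 < d)
    (H : AddSubmonoid (Fin d → ℕ)) (hFG : H.FG)
    (hFE : FullyEmbedded H) (hNor : Normal H)
    (a : Fin d → (Fin d → ℕ)) (hS : SimplicialWithRays H a)
    (K : Type*) [Field K]
    (b : Fin d → ℕ) (hbH : b ∈ H) (hb0 : b ≠ 0) :
    RingTheory.Sequence.IsRegular (sgRing K H)
      (xpow K hbH ::
        List.ofFn (fun j : Fin (d - 1) =>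
          xpow K (hS.1 ⟨0, hd⟩) - xpow K (hS.1 ⟨j.1 + 1, by omega⟩))) := by
  obtain ⟨⟨B, hBH, hinj, hsurj⟩, N, hN, hpow⟩ := exists_decomposition hFG hNor hS
  let : Algebra (MvPolynomial (Fin d) K) (sgRing K H) := (rayHom K hS.1).toAlgebra
  have : IsScalarTower K (MvPolynomial (Fin d) K) (sgRing K H) :=
    IsScalarTower.of_algebraMap_eq fun r => ((rayHom K hS.1).commutes r).symm
  have hmem : ∀ p : (Σ _ : B, Fin d →₀ ℕ), p.1.1 + ∑ i, p.2 i • a i ∈ H := fun p =>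
    add_mem (hBH p.1.2) (sum_mem fun i _ => nsmul_mem (hS.1 i) _)
  obtain ⟨v, hv⟩ := exists_basis_xpow (K := K) (H := H)
    (fun p : (Σ _ : B, Fin d →₀ ℕ) => p.1.1 + ∑ i, p.2 i • a i)
    (by
      rintro ⟨⟨g, hg⟩, m⟩ ⟨⟨g', hg'⟩, m'⟩ h
      obtain ⟨rfl, hm⟩ := hinj g hg g' hg' m m' h
      rw [DFunLike.coe_injective hm])
    hmem
    (fun h hh => by
      obtain ⟨g, hg, m, rfl⟩ := hsurj h hh
      exact ⟨⟨⟨g, hg⟩, Finsupp.equivFunOnFinite.symm m⟩, rfl⟩)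
  have : Module.Free (MvPolynomial (Fin d) K) (sgRing K H) := by
    refine free_of_basis_monomial_smul (fun g : B => xpow K (hBH g.2)) v fun p => ?_
    rw [hv, Algebra.smul_def]
    refine Subtype.ext ?_
    change mono K _ = (rayHom K hS.1 (monomial p.2 1) : MvPolynomial (Fin d) K) * mono K p.1.1
    rw [coe_rayHom_monomial, ← mono_add, add_comm]
  obtain ⟨m, hm⟩ := hpow b hbH
  have hx : xpow K hbH ^ N = algebraMap (MvPolynomial (Fin d) K) (sgRing K H)
      (monomial (Finsupp.equivFunOnFinite.symm m) 1) := by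
    refine Subtype.ext ?_
    change mono K b ^ N = (rayHom K hS.1 _ : MvPolynomial (Fin d) K)
    rw [coe_rayHom_monomial, ← mono_nsmul, hm]
    rfl
  have hlist : (diffList K d hd).map (algebraMap _ (sgRing K H)) =
      List.ofFn (fun j : Fin (d - 1) =>
        xpow K (hS.1 ⟨0, hd⟩) - xpow K (hS.1 ⟨j.1 + 1, by omega⟩)) := by
    rw [diffList, List.map_ofFn]
    congr 1
    ext1 j
    change rayHom K hS.1 _ = _
    simp [rayHom, add_comm]
  have hreg := isWeaklyRegular_cons_map_diffList hd hN hx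
  rw [hlist] at hreg
  refine ⟨hreg, fun htop => ?_⟩
  rw [smul_eq_mul, Ideal.mul_top] at htop
  have ha0 : ∀ i, a i ≠ 0 := fun i hi => hS.2.2.2.1.ne_zero i (by ext; simp [toR, hi])
  let ε : sgRing K H →+* K := (constantCoeff).comp (sgRing K H).val.toRingHom
  have hε : ∀ {h} (hh : h ∈ H), h ≠ 0 → ε (xpow K hh) = 0 := fun _ h0 => constantCoeff_mono h0
  have hker : Ideal.ofList (xpow K hbH :: List.ofFn (fun j : Fin (d - 1) =>
      xpow K (hS.1 ⟨0, hd⟩) - xpow K (hS.1 ⟨j.1 + 1, by omega⟩))) ≤ RingHom.ker ε := by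
    refine Ideal.span_le.mpr fun p hp => ?_
    obtain rfl | hp := List.mem_cons.mp hp
    · exact hε hbH hb0
    · obtain ⟨j, rfl⟩ := (List.mem_ofFn' _ _).mp hp
      change ε _ = 0
      rw [map_sub, hε _ (ha0 _), hε _ (ha0 _), sub_zero]
  exact RingHom.ker_ne_top ε (top_le_iff.mp (htop.le.trans hker))

end AffineSG
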